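/- Let γ: [0,1] → X be an absolutely continuous curve in a metric space, φ: X → ℝ∪{-∞} upper semicontinuous with φ(γ_s) > -∞ for a.e. s ∈ [0,1], and g: X → [0,∞] with s ↦ g(γ_s)|γ'_s| in L¹(0,1). If φ(γ_s) - φ(γ_t) ≤ g(γ_t)·|∫ₛᵗ |γ'_r| dr| holds for all t with φ(γ_t) > -∞, then s ↦ φ(γ_s) is real valued and absolutely continuous on [0,1]. -/

import Mathlib

open Filter Topology MeasureTheory
open scoped ENNReal

lemma aux_ac_of_dist_le {f G : ℝ → ℝ} {a b : ℝ} (hG : AbsolutelyContinuousOnInterval G a b)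
    (h : ∀ x ∈ Set.uIcc a b, ∀ y ∈ Set.uIcc a b, dist (f x) (f y) ≤ dist (G x) (G y)) :
    AbsolutelyContinuousOnInterval f a b := by
  rw [absolutelyContinuousOnInterval_iff] at hG ⊢
  intro ε hε
  obtain ⟨δ, hδ, H⟩ := hG ε hε
  refine ⟨δ, hδ, fun E hE hlt => lt_of_le_of_lt ?_ (H E hE hlt)⟩
  refine Finset.sum_le_sum fun i hi => ?_
  exact h _ (hE.1 i hi).1 _ (hE.1 i hi).2

lemma aux_deriv_bound {f F : ℝ → ℝ} {s v C : ℝ} (hf : DifferentiableAt ℝ f s)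
    (hF : HasDerivAt F v s) (h : ∀ x, f x - f s ≤ C * |F x - F s|) :
    |deriv f s| ≤ C * |v| := by
  have h1 := hasDerivAt_iff_tendsto_slope.1 hf.hasDerivAt
  have h2 : Tendsto (fun x => C * |slope F s x|) (𝓝[≠] s) (𝓝 (C * |v|)) :=
    ((hasDerivAt_iff_tendsto_slope.1 hF).abs).const_mul C
  have hr : 𝓝[>] s ≤ 𝓝[≠] s := nhdsWithin_mono _ (fun x hx => ne_of_gt hx)
  have hl : 𝓝[<] s ≤ 𝓝[≠] s := nhdsWithin_mono _ (fun x hx => ne_of_lt hx)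
  rw [abs_le']
  constructor
  · refine le_of_tendsto_of_tendsto (h1.mono_left hr) (h2.mono_left hr) ?_
    filter_upwards [self_mem_nhdsWithin] with x hx
    have hx' : 0 < x - s := sub_pos.2 hx
    rw [slope_def_field, slope_def_field, abs_div, abs_of_pos hx', ← mul_div_assoc]
    exact div_le_div_of_nonneg_right (h x) hx'.le
  · refine le_of_tendsto_of_tendsto (h1.neg.mono_left hl) (h2.mono_left hl) ?_
    filter_upwards [self_mem_nhdsWithin] with x hx
    have hx' : 0 < s - x := sub_pos.2 hx
    rw [slope_def_field, slope_def_field, abs_div, abs_sub_comm x s, abs_of_pos hx',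
      ← mul_div_assoc, ← neg_sub s x, div_neg, neg_neg]
    exact div_le_div_of_nonneg_right (h x) hx'.le

/-- Lipschitz regularization of `p` relative to `F`. -/
noncomputable def auxReg (T : Set ℝ) (p F : ℝ → ℝ) (n : ℕ) (s : ℝ) : ℝ :=
  ⨆ t : T, (p t - n * |F s - F t|)

section reg
variable {T : Set ℝ} {p F : ℝ → ℝ} {M : ℝ}

lemma auxReg_bdd (hM : ∀ t ∈ T, p t ≤ M) (n : ℕ) (s : ℝ) :
    BddAbove (Set.range fun t : T => p t - n * |F s - F t|) := by
  refine ⟨M, ?_⟩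
  rintro _ ⟨t, rfl⟩
  have := hM t t.2
  have : (0 : ℝ) ≤ n * |F s - F t| := by positivity
  simp only
  linarith

lemma auxReg_ge (hM : ∀ t ∈ T, p t ≤ M) (n : ℕ) (s : ℝ) {t : ℝ} (ht : t ∈ T) :
    p t - n * |F s - F t| ≤ auxReg T p F n s :=
  le_ciSup (auxReg_bdd hM n s) (⟨t, ht⟩ : T)

lemma auxReg_le (hT : T.Nonempty) {n : ℕ} {s c : ℝ}
    (h : ∀ t ∈ T, p t - n * |F s - F t| ≤ c) : auxReg T p F n s ≤ c := by
  have := hT.to_subtype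
  exact ciSup_le fun t => h t t.2

lemma auxReg_lip (hT : T.Nonempty) (hM : ∀ t ∈ T, p t ≤ M) (n : ℕ) (x s : ℝ) :
    auxReg T p F n x - auxReg T p F n s ≤ n * |F x - F s| := by
  rw [sub_le_iff_le_add]
  refine auxReg_le hT fun t ht => ?_
  have h1 := auxReg_ge (F := F) hM n s ht
  have h2 : |F s - F t| ≤ |F x - F s| + |F x - F t| := by
    rw [abs_sub_comm (F x) (F s)]; exact abs_sub_le _ _ _
  have h3 := mul_le_mul_of_nonneg_left h2 (Nat.cast_nonneg (α := ℝ) n)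
  linarith

lemma auxReg_slope (hT : T.Nonempty) (hM : ∀ t ∈ T, p t ≤ M) (n : ℕ) (x : ℝ) {s C : ℝ}
    (hC0 : 0 ≤ C) (hs : s ∈ T) (hC : ∀ t ∈ T, p t - p s ≤ C * |F t - F s|) :
    auxReg T p F n x - auxReg T p F n s ≤ C * |F x - F s| := by
  rcases le_total (n : ℝ) C with h | h
  · exact (auxReg_lip hT hM n x s).trans (mul_le_mul_of_nonneg_right h (abs_nonneg _))
  · have h0 := auxReg_ge (F := F) hM n s hs
    simp only [sub_self, abs_zero, mul_zero, sub_zero] at h0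
    have : auxReg T p F n x ≤ p s + C * |F x - F s| := by
      refine auxReg_le hT fun t ht => ?_
      have h1 := hC t ht
      have h2 : |F t - F s| ≤ |F x - F t| + |F x - F s| := by
        rw [abs_sub_comm (F x) (F t)]; exact abs_sub_le _ _ _
      have h3 := mul_le_mul_of_nonneg_left h2 hC0
      have h4 := mul_le_mul_of_nonneg_right h (abs_nonneg (F x - F t))
      linarith
    linarith

lemma auxReg_eventually (hT : T.Nonempty) (hM : ∀ t ∈ T, p t ≤ M) {s c δ : ℝ} (hδ : 0 < δ)
    (h : ∀ t ∈ T, |F s - F t| < δ → p t ≤ c) : ∃ n : ℕ, auxReg T p F n s ≤ c := by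
  obtain ⟨n, hn⟩ := exists_nat_ge ((M - c) / δ)
  rw [div_le_iff₀ hδ] at hn
  refine ⟨n, auxReg_le hT fun t ht => ?_⟩
  have h0 : (0 : ℝ) ≤ n * |F s - F t| := by positivity
  rcases lt_or_ge (|F s - F t|) δ with h1 | h1
  · have := h t ht h1
    linarith
  · have := mul_le_mul_of_nonneg_left h1 (Nat.cast_nonneg (α := ℝ) n)
    have := hM t ht
    linarith

end reg

/-- The real-variable core. -/
lemma aux_core (T : Set ℝ) (p sp : ℝ → ℝ) (M : ℝ) (G : ℝ → ℝ≥0∞) (hT : T.Nonempty)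
    (hM : ∀ t ∈ T, p t ≤ M) (hsp : Integrable sp) (hsp0 : ∀ x, 0 ≤ sp x)
    (hae : ∀ᵐ s ∂(volume.restrict (Set.Icc (0 : ℝ) 1)), s ∈ T)
    (hint : ∫⁻ s in Set.Icc (0 : ℝ) 1, G s * ENNReal.ofReal (sp s) ≠ ⊤)
    (hmain : ∀ t ∈ T, G t ≠ ⊤ → ∀ s ∈ T, p s - p t ≤
      (G t).toReal * |(∫ r in (0:ℝ)..s, sp r) - ∫ r in (0:ℝ)..t, sp r|) :
    ∃ k : ℝ → ℝ, IntegrableOn k (Set.Icc (0 : ℝ) 1) ∧ (∀ x, 0 ≤ k x) ∧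
      ∀ n : ℕ, ∀ a ∈ Set.Icc (0 : ℝ) 1, ∀ b ∈ Set.Icc (0 : ℝ) 1,
        |auxReg T p (fun x => ∫ r in (0:ℝ)..x, sp r) n a -
          auxReg T p (fun x => ∫ r in (0:ℝ)..x, sp r) n b| ≤ |∫ r in a..b, k r| := by
  set F : ℝ → ℝ := fun x => ∫ r in (0:ℝ)..x, sp r with hF
  set w := auxReg T p F with hw
  have hlip : ∀ n x y, |w n x - w n y| ≤ n * |F x - F y| := by
    intro n x y
    rw [abs_le']
    refine ⟨auxReg_lip hT hM n x y, ?_⟩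
    rw [neg_sub, abs_sub_comm]
    exact auxReg_lip hT hM n y x
  have hac : ∀ n a b, AbsolutelyContinuousOnInterval (w n) a b := by
    intro n a b
    have h0 : AbsolutelyContinuousOnInterval F (min 0 (min a b)) (max 0 (max a b)) :=
      (hsp.intervalIntegrable).absolutelyContinuousOnInterval_intervalIntegral (by
        rw [Set.uIcc_of_le (by simp)]; simp)
    have h1 : AbsolutelyContinuousOnInterval F a b := h0.mono (by
      rw [Set.uIcc_of_le (a := min 0 (min a b)) (by simp)]
      intro x hx
      rw [Set.mem_uIcc] at hx
      simp only [Set.mem_Icc, inf_le_iff, le_sup_iff]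
      tauto)
    refine aux_ac_of_dist_le (h1.const_mul (n : ℝ)) fun x _ y _ => ?_
    rw [Real.dist_eq, Real.dist_eq, ← mul_sub, abs_mul, Nat.abs_cast]
    exact hlip n x y
  have hdiff : ∀ᵐ x ∂(volume.restrict (Set.Icc (0 : ℝ) 1)), ∀ n, DifferentiableAt ℝ (w n) x := by
    rw [ae_all_iff]
    intro n
    rw [ae_restrict_iff' measurableSet_Icc]
    filter_upwards [(hac n 0 1).ae_differentiableAt] with x hx hx'
    exact hx (by rwa [Set.uIcc_of_le zero_le_one])
  have hFd : ∀ᵐ x ∂(volume.restrict (Set.Icc (0 : ℝ) 1)), HasDerivAt F (sp x) x := by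
    refine ae_restrict_of_ae ?_
    filter_upwards [LocallyIntegrable.ae_hasDerivAt_integral hsp.locallyIntegrable] with x hx
    exact hx 0
  have hbound : ∀ᵐ x ∂(volume.restrict (Set.Icc (0 : ℝ) 1)), ∀ n,
      ‖deriv (w n) x‖ₑ ≤ G x * ENNReal.ofReal (sp x) := by
    filter_upwards [hdiff, hFd, hae] with x h1 h2 h3 n
    rw [← ofReal_norm, Real.norm_eq_abs]
    by_cases hG : G x = ⊤
    · rcases (hsp0 x).eq_or_lt with h0 | h0
      · have := aux_deriv_bound (C := n) (h1 n) h2 fun y => (auxReg_lip hT hM n y x)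
        rw [← h0, abs_zero, mul_zero] at this
        rw [ENNReal.ofReal_of_nonpos this]
        exact zero_le
      · rw [hG, ENNReal.top_mul (by simpa using h0)]
        exact le_top
    · have := aux_deriv_bound (C := (G x).toReal) (h1 n) h2 fun y =>
        auxReg_slope hT hM n y ENNReal.toReal_nonneg h3 (hmain x h3 hG)
      rw [abs_of_nonneg (hsp0 x)] at this
      calc _ ≤ _ := ENNReal.ofReal_le_ofReal this
        _ = _ := by rw [ENNReal.ofReal_mul ENNReal.toReal_nonneg, ENNReal.ofReal_toReal hG]
  set K : ℝ → ℝ≥0∞ := fun x => ⨆ n, ‖deriv (w n) x‖ₑ with hK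
  have hKm : Measurable K := Measurable.iSup fun n => (measurable_deriv (w n)).enorm
  have hKfin : ∫⁻ x in Set.Icc (0 : ℝ) 1, K x ≠ ⊤ := by
    refine ne_top_of_le_ne_top hint (lintegral_mono_ae ?_)
    filter_upwards [hbound] with x hx
    exact iSup_le hx
  have hKae := ae_lt_top hKm hKfin
  have hki : IntegrableOn (fun x => (K x).toReal) (Set.Icc (0 : ℝ) 1) :=
    integrable_toReal_of_lintegral_ne_top hKm.aemeasurable hKfin
  have hkey : ∀ n : ℕ, ∀ a ∈ Set.Icc (0 : ℝ) 1, ∀ b ∈ Set.Icc (0 : ℝ) 1,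
        |w n a - w n b| ≤ |∫ r in a..b, (K r).toReal| := by
    intro n a ha b hb
    rw [abs_sub_comm, ← (hac n a b).integral_deriv_eq_sub, ← Real.norm_eq_abs]
    have hsub : Set.uIoc a b ⊆ Set.Icc 0 1 :=
      Set.uIoc_subset_uIcc.trans (Set.uIcc_subset_Icc ha hb)
    refine intervalIntegral.norm_integral_le_abs_of_norm_le ?_ ?_
    · filter_upwards [ae_restrict_of_ae_restrict_of_subset hsub hKae] with x hx
      rw [← toReal_enorm]
      exact ENNReal.toReal_mono hx.ne (le_iSup (fun n => ‖deriv (w n) x‖ₑ) n)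
    · exact intervalIntegrable_iff.2 (hki.mono_set hsub)
  exact ⟨_, hki, fun x => ENNReal.toReal_nonneg, hkey⟩

/-- Absolute continuity of `φ ∘ γ` along an absolutely continuous curve: if `γ` is an
absolutely continuous curve in a metric space with (integrable, nonnegative) speed
`|γ'|`, `φ : X → ℝ ∪ {-∞}` is upper semicontinuous and finite at `γ_s` for a.e. `s`,
`g : X → [0,∞]` satisfies `∫₀¹ g(γ_s)|γ'_s| ds < ∞`, and
`φ(γ_s) - φ(γ_t) ≤ g(γ_t)·|∫ₛᵗ |γ'_r| dr|` whenever `φ(γ_t) > -∞`, then `s ↦ φ(γ_s)` is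
real valued and absolutely continuous on `[0,1]` (i.e. it is the indefinite integral of
an integrable function). -/
theorem ac_of_potential_along_curve {X : Type*} [MetricSpace X]
    (γ : ℝ → X) (speed : ℝ → ℝ)
    (hsp0 : ∀ r ∈ Set.Icc (0 : ℝ) 1, 0 ≤ speed r)
    (hspint : IntegrableOn speed (Set.Icc (0 : ℝ) 1))
    (hγac : ∀ s t : ℝ, s ∈ Set.Icc (0 : ℝ) 1 → t ∈ Set.Icc (0 : ℝ) 1 → s ≤ t →
      dist (γ s) (γ t) ≤ ∫ r in s..t, speed r)
    (φ : X → EReal) (hφtop : ∀ x, φ x ≠ ⊤)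
    (husc : UpperSemicontinuous φ)
    (hae : ∀ᵐ s ∂(volume.restrict (Set.Icc (0 : ℝ) 1)), φ (γ s) ≠ ⊥)
    (g : X → ℝ≥0∞)
    (hint : ∫⁻ s in Set.Icc (0 : ℝ) 1, g (γ s) * ENNReal.ofReal (speed s) ≠ ⊤)
    (hmain : ∀ t ∈ Set.Icc (0 : ℝ) 1, φ (γ t) ≠ ⊥ → ∀ s ∈ Set.Icc (0 : ℝ) 1,
      φ (γ s) - φ (γ t) ≤
        (g (γ t) : EReal) * ((ENNReal.ofReal |∫ r in s..t, speed r| : ℝ≥0∞) : EReal)) :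
    ∃ u : ℝ → ℝ,
      (∀ s ∈ Set.Icc (0 : ℝ) 1, φ (γ s) = ((u s : ℝ) : EReal)) ∧
      ∃ h : ℝ → ℝ, IntegrableOn h (Set.Icc (0 : ℝ) 1) ∧
        ∀ s ∈ Set.Icc (0 : ℝ) 1, u s = u 0 + ∫ r in (0 : ℝ)..s, h r := by
  set sp : ℝ → ℝ := (Set.Icc (0 : ℝ) 1).indicator speed with hspdef
  have hsp : Integrable sp := hspint.integrable_indicator measurableSet_Icc
  have hspnn : ∀ x, 0 ≤ sp x := fun x => Set.indicator_nonneg hsp0 x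
  set F : ℝ → ℝ := fun x => ∫ r in (0:ℝ)..x, sp r with hF
  have hFeq : ∀ s ∈ Set.Icc (0 : ℝ) 1, ∀ t ∈ Set.Icc (0 : ℝ) 1,
      ∫ r in s..t, speed r = F t - F s := by
    intro s hs t ht
    rw [hF]
    simp only
    rw [intervalIntegral.integral_interval_sub_left hsp.intervalIntegrable hsp.intervalIntegrable]
    refine intervalIntegral.integral_congr fun x hx => ?_
    have : x ∈ Set.Icc (0 : ℝ) 1 := Set.uIcc_subset_Icc hs ht hx
    simp [hspdef, Set.indicator_of_mem this]
  have hdist : ∀ s ∈ Set.Icc (0 : ℝ) 1, ∀ t ∈ Set.Icc (0 : ℝ) 1,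
      dist (γ t) (γ s) ≤ |F s - F t| := by
    intro s hs t ht
    rcases le_total s t with h | h
    · have := hγac s t hs ht h
      rw [hFeq s hs t ht] at this
      rw [dist_comm, abs_sub_comm]
      exact this.trans (le_abs_self _)
    · have := hγac t s ht hs h
      rw [hFeq t ht s hs] at this
      exact this.trans (le_abs_self _)
  have hFc : Continuous F := intervalIntegral.continuous_primitive
    (fun a b => hsp.intervalIntegrable) 0
  have hγc : ContinuousOn γ (Set.Icc 0 1) := by
    intro s hs
    rw [ContinuousWithinAt, tendsto_iff_dist_tendsto_zero]
    have hlim : Tendsto (fun t => |F s - F t|) (𝓝[Set.Icc 0 1] s) (𝓝 0) := by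
      have : Continuous fun t => |F s - F t| := by fun_prop
      have h := this.continuousWithinAt (s := Set.Icc 0 1) (x := s)
      simpa [ContinuousWithinAt] using h
    refine squeeze_zero' (Eventually.of_forall fun _ => dist_nonneg) ?_ hlim
    filter_upwards [self_mem_nhdsWithin] with t ht
    exact hdist s hs t ht
  set T : Set ℝ := {t | t ∈ Set.Icc (0 : ℝ) 1 ∧ φ (γ t) ≠ ⊥} with hTdef
  set p : ℝ → ℝ := fun t => (φ (γ t)).toReal with hp
  have hpT : ∀ t ∈ T, φ (γ t) = (p t : EReal) := fun t ht =>
    (EReal.coe_toReal (hφtop _) ht.2).symm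
  have haeT : ∀ᵐ s ∂(volume.restrict (Set.Icc (0 : ℝ) 1)), s ∈ T := by
    filter_upwards [hae, ae_restrict_mem measurableSet_Icc] with s h1 h2 using ⟨h2, h1⟩
  have hT : T.Nonempty := by
    have : NeZero (volume.restrict (Set.Icc (0 : ℝ) 1)) := ⟨by
      rw [Ne, Measure.restrict_eq_zero]; simp⟩
    exact haeT.exists
  obtain ⟨M, hM⟩ : ∃ M : ℝ, ∀ t ∈ T, p t ≤ M := by
    obtain ⟨x, hx, hmax⟩ := UpperSemicontinuousOn.exists_isMaxOn
      (s := γ '' Set.Icc (0:ℝ) 1) (f := φ) ((Set.nonempty_Icc.2 zero_le_one).image γ)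
      (isCompact_Icc.image_of_continuousOn hγc) (husc.upperSemicontinuousOn _)
    refine ⟨(φ x).toReal, fun t ht => ?_⟩
    exact EReal.toReal_le_toReal (hmax (Set.mem_image_of_mem γ ht.1)) ht.2 (hφtop _)
  have hint' : ∫⁻ s in Set.Icc (0 : ℝ) 1, g (γ s) * ENNReal.ofReal (sp s) ≠ ⊤ := by
    rw [setLIntegral_congr_fun (g := fun s => g (γ s) * ENNReal.ofReal (speed s))
      measurableSet_Icc]
    · exact hint
    · intro s hs
      simp [hspdef, Set.indicator_of_mem hs]
  obtain ⟨k, hki, hk0, hk⟩ := aux_core T p sp M (fun s => g (γ s)) hT hM hsp hspnn haeT hint' (by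
    intro t ht hgt s hs
    have h := hmain t ht.1 ht.2 s hs.1
    rw [hpT t ht, hpT s hs, hFeq s hs.1 t ht.1] at h
    change p s - p t ≤ (g (γ t)).toReal * |F s - F t|
    rw [← ENNReal.ofReal_toReal hgt, EReal.coe_ennreal_ofReal, EReal.coe_ennreal_ofReal,
      max_eq_left ENNReal.toReal_nonneg, max_eq_left (abs_nonneg _)] at h
    rw [abs_sub_comm]
    exact_mod_cast h)
  rw [← hF] at hk
  have hlow : ∀ n, ∀ t ∈ T, p t ≤ auxReg T p F n t := by
    intro n t ht
    simpa using auxReg_ge (F := F) hM n t ht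
  have hup : ∀ s ∈ Set.Icc (0:ℝ) 1, ∀ c : ℝ, φ (γ s) < c → ∃ n : ℕ, auxReg T p F n s ≤ c := by
    intro s hs c hc
    obtain ⟨δ, hδ, H⟩ := Metric.eventually_nhds_iff.1 (husc (γ s) _ hc)
    refine auxReg_eventually hT hM hδ fun t ht hlt => ?_
    have : φ (γ t) < c := H ((hdist s hs t ht.1).trans_lt hlt)
    rw [hpT t ht] at this
    exact (EReal.coe_lt_coe_iff.1 this).le
  have hTall : ∀ s ∈ Set.Icc (0:ℝ) 1, s ∈ T := by
    intro s hs
    refine ⟨hs, fun hbot => ?_⟩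
    obtain ⟨t, ht⟩ := hT
    obtain ⟨n, hn⟩ := hup s hs (p t - |∫ r in s..t, k r| - 1) (by
      rw [hbot]; exact EReal.bot_lt_coe _)
    have h1 := hk n s hs t ht.1
    have h2 := hlow n t ht
    have h3 := (abs_le.1 h1).1
    linarith
  have hle : ∀ s ∈ Set.Icc (0:ℝ) 1, ∀ t ∈ Set.Icc (0:ℝ) 1, p t - p s ≤ |∫ r in s..t, k r| := by
    intro s hs t ht
    refine le_of_forall_pos_le_add fun ε hε => ?_
    obtain ⟨n, hn⟩ := hup s hs (p s + ε) (by
      rw [hpT s (hTall s hs)]; exact EReal.coe_lt_coe_iff.2 (by linarith))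
    have h1 := (abs_le.1 (hk n s hs t ht)).1
    have h2 := hlow n t (hTall t ht)
    linarith
  have hkI : ∀ a ∈ Set.Icc (0:ℝ) 1, ∀ b ∈ Set.Icc (0:ℝ) 1, IntervalIntegrable k volume a b := by
    intro a ha b hb
    exact intervalIntegrable_iff.2 (hki.mono_set
      (Set.uIoc_subset_uIcc.trans (Set.uIcc_subset_Icc ha hb)))
  have h01 : (0:ℝ) ∈ Set.Icc (0:ℝ) 1 := ⟨le_rfl, zero_le_one⟩
  have h11 : (1:ℝ) ∈ Set.Icc (0:ℝ) 1 := ⟨zero_le_one, le_rfl⟩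
  have hac : AbsolutelyContinuousOnInterval p 0 1 := by
    refine aux_ac_of_dist_le ((hkI 0 h01 1 h11).absolutelyContinuousOnInterval_intervalIntegral
      (c := 0) (by simp)) fun x hx y hy => ?_
    rw [Set.uIcc_of_le zero_le_one] at hx hy
    rw [Real.dist_eq, Real.dist_eq, intervalIntegral.integral_interval_sub_left
      (hkI 0 h01 x hx) (hkI 0 h01 y hy), abs_le']
    refine ⟨hle y hy x hx, ?_⟩
    rw [neg_sub, intervalIntegral.integral_symm, abs_neg]
    exact hle x hx y hy
  refine ⟨p, fun s hs => hpT s (hTall s hs), deriv p, ?_, fun s hs => ?_⟩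
  · exact (intervalIntegrable_iff_integrableOn_Icc_of_le zero_le_one).1
      hac.intervalIntegrable_deriv
  · have : AbsolutelyContinuousOnInterval p 0 s := hac.mono (by
      rw [Set.uIcc_of_le hs.1, Set.uIcc_of_le zero_le_one]
      exact Set.Icc_subset_Icc_right hs.2)
    rw [this.integral_deriv_eq_sub]
    ring
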